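/- arXiv:2511.14501 — 3 statements merged into one kernel-verified Lean document; each statement's English description precedes it below -/
import Mathlib

section
/- Let f : ℝ^d → ℝ be differentiable and L-smooth. Let x ∈ ℝ^d, let g ∈ ℝ^d with g ≠ 0, let γ ≥ 0, and set y = x − γ·g/‖g‖. Then f(y) ≤ f(x) − γ‖∇f(x)‖ + 2γ‖∇f(x) − g‖ + (L/2)γ². -/
/-- Descent lemma: a differentiable function with `L`-Lipschitz gradient lies below its
quadratic upper model. -/
theorem le_quadratic_of_lipschitz_gradient {E : Type*} [NormedAddCommGroup E]
    [InnerProductSpace ℝ E] [CompleteSpace E] {f : E → ℝ} {L : ℝ} (hf : Differentiable ℝ f)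
    (hL : ∀ a b : E, ‖gradient f a - gradient f b‖ ≤ L * ‖a - b‖) (x v : E) :
    f (x + v) ≤ f x + inner ℝ (gradient f x) v + L / 2 * ‖v‖ ^ 2 := by
  have hline (t : ℝ) : HasDerivAt (fun t : ℝ => f (x + t • v))
      (inner ℝ (gradient f (x + t • v)) v) t := by
    have hray : HasDerivAt (fun t : ℝ => x + t • v) v t := by
      simpa using ((hasDerivAt_id t).smul_const v).const_add x
    exact (hf (x + t • v)).hasGradientAt.hasFDerivAt.comp_hasDerivAt t hray
  have hmodel (t : ℝ) : HasDerivAt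
      (fun t : ℝ => f x + t * inner ℝ (gradient f x) v + L / 2 * ‖v‖ ^ 2 * t ^ 2)
      (inner ℝ (gradient f x) v + L * ‖v‖ ^ 2 * t) t := by
    refine ((((hasDerivAt_id t).mul_const (inner ℝ (gradient f x) v)).const_add (f x)).add
      (((hasDerivAt_id t).pow 2).const_mul (L / 2 * ‖v‖ ^ 2))).congr_deriv ?_
    simp
    ring
  have key := image_le_of_deriv_right_le_deriv_boundary (a := 0) (b := 1)
    (fun t _ => (hline t).continuousAt.continuousWithinAt)
    (fun t _ => (hline t).hasDerivWithinAt) (by simp)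
    (fun t _ => (hmodel t).continuousAt.continuousWithinAt)
    (fun t _ => (hmodel t).hasDerivWithinAt)
    (fun t ht => by
      have hcs := real_inner_le_norm (gradient f (x + t • v) - gradient f x) v
      have hlip := hL (x + t • v) x
      rw [add_sub_cancel_left, norm_smul, Real.norm_of_nonneg ht.1] at hlip
      rw [inner_sub_left] at hcs
      nlinarith [mul_le_mul_of_nonneg_right hlip (norm_nonneg v)])
    (Set.right_mem_Icc.mpr zero_le_one)
  simpa using key

/-- The component of `a` along the direction of `g` is at least `‖a‖ - 2 * ‖a - g‖`. -/
theorem norm_sub_two_mul_norm_sub_le_inner_div_norm {E : Type*} [NormedAddCommGroup E]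
    [InnerProductSpace ℝ E] (a : E) {g : E} (hg : g ≠ 0) :
    ‖a‖ - 2 * ‖a - g‖ ≤ inner ℝ a g / ‖g‖ := by
  have hpos : 0 < ‖g‖ := norm_pos_iff.mpr hg
  rw [le_div_iff₀ hpos]
  have hcs := neg_le_of_abs_le (abs_real_inner_le_norm (a - g) g)
  rw [inner_sub_left, real_inner_self_eq_norm_sq] at hcs
  nlinarith [mul_le_mul_of_nonneg_right (norm_sub_norm_le a g) hpos.le]

/-- One-step descent inequality for the normalized gradient update
`y = x − γ·g/‖g‖` for a differentiable `L`-smooth function `f : ℝ^d → ℝ`. -/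
theorem stmt1 {d : ℕ} (f : EuclideanSpace ℝ (Fin d) → ℝ) (L : ℝ)
    (hdiff : Differentiable ℝ f)
    (hsmooth : ∀ a b : EuclideanSpace ℝ (Fin d),
      ‖gradient f a - gradient f b‖ ≤ L * ‖a - b‖)
    (x g : EuclideanSpace ℝ (Fin d)) (hg : g ≠ 0) (γ : ℝ) (hγ : 0 ≤ γ) :
    f (x - (γ / ‖g‖) • g) ≤
      f x - γ * ‖gradient f x‖ + 2 * γ * ‖gradient f x - g‖ + L / 2 * γ ^ 2 := by
  have hdescent := le_quadratic_of_lipschitz_gradient hdiff hsmooth x (-((γ / ‖g‖) • g))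
  have hnorm : ‖(γ / ‖g‖) • g‖ = γ := by
    rw [norm_smul, norm_div, norm_norm, div_mul_cancel₀ _ (norm_ne_zero_iff.mpr hg),
      Real.norm_of_nonneg hγ]
  rw [← sub_eq_add_neg, norm_neg, hnorm, inner_neg_right, real_inner_smul_right,
    div_mul_eq_mul_div, mul_div_assoc] at hdescent
  nlinarith [mul_le_mul_of_nonneg_left
    (norm_sub_two_mul_norm_sub_le_inner_div_norm (gradient f x) hg) hγ]
end

section
/- Let f₁, …, f_n : ℝ^d → ℝ be differentiable and set f = (1/n)∑_{i=1}^n f_i. Assume f is L-smooth and bounded below with infimum f^inf. Let x ∈ ℝ^d, let g₁, …, g_n, v₁, …, v_n ∈ ℝ^d, set g = (1/n)∑_i g_i and v = (1/n)∑_i v_i, assume g ≠ 0, let γ ≥ 0 and y = x − γ·g/‖g‖. Then (f(y) − f^inf) + γ‖∇f(x)‖ ≤ (f(x) − f^inf) + 2γ‖v − ∇f(x)‖ + (2γ/n)∑_{i=1}^n ‖g_i − v_i‖ + (L/2)γ². -/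
open Set in
/-- Quadratic upper bound for a differentiable function with Lipschitz gradient. -/
theorem le_add_inner_gradient_add_sq_of_lipschitz_gradient {E : Type*} [NormedAddCommGroup E]
    [InnerProductSpace ℝ E] [CompleteSpace E] {F : E → ℝ} {L : ℝ} (hF : Differentiable ℝ F)
    (hL : ∀ a b, ‖gradient F a - gradient F b‖ ≤ L * ‖a - b‖) (x h : E) :
    F (x + h) ≤ F x + inner ℝ (gradient F x) h + L / 2 * ‖h‖ ^ 2 := by
  have hderiv (t : ℝ) :
      HasDerivAt (fun t : ℝ => F (x + t • h)) (inner ℝ (gradient F (x + t • h)) h) t := by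
    have hline : HasDerivAt (fun t : ℝ => x + t • h) h t := by
      simpa using ((hasDerivAt_id t).smul_const h).const_add x
    exact (hF (x + t • h)).hasGradientAt.hasFDerivAt.comp_hasDerivAt t hline
  have hbound (t : ℝ) :
      HasDerivAt (fun t : ℝ => F x + t * inner ℝ (gradient F x) h + L / 2 * ‖h‖ ^ 2 * t ^ 2)
        (inner ℝ (gradient F x) h + L * ‖h‖ ^ 2 * t) t := by
    have h₁ := ((hasDerivAt_id t).mul_const (inner ℝ (gradient F x) h)).const_add (F x)
    have h₂ := (hasDerivAt_pow 2 t).const_mul (L / 2 * ‖h‖ ^ 2)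
    refine (h₁.add h₂).congr_deriv ?_
    norm_num
    ring
  have key := image_le_of_deriv_right_le_deriv_boundary (a := 0) (b := 1)
    (fun t _ => (hderiv t).continuousAt.continuousWithinAt)
    (fun t _ => (hderiv t).hasDerivWithinAt) (by simp)
    (fun t _ => (hbound t).continuousAt.continuousWithinAt)
    (fun t _ => (hbound t).hasDerivWithinAt)
    (fun t ht => by
      have hlip := hL (x + t • h) x
      rw [add_sub_cancel_left, norm_smul, Real.norm_of_nonneg ht.1] at hlip
      have hinner := real_inner_le_norm (gradient F (x + t • h) - gradient F x) h
      rw [inner_sub_left] at hinner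
      have hmul := mul_le_mul_of_nonneg_right hlip (norm_nonneg h)
      linarith)
    (right_mem_Icc.2 zero_le_one)
  simpa using key

/-- One normalized step along `-g`, where `g` estimates the gradient. -/
theorem normalized_step_le {E : Type*} [NormedAddCommGroup E]
    [InnerProductSpace ℝ E] [CompleteSpace E] {F : E → ℝ} {L : ℝ} (hF : Differentiable ℝ F)
    (hL : ∀ a b, ‖gradient F a - gradient F b‖ ≤ L * ‖a - b‖) (x : E) {g : E} (hg : g ≠ 0)
    {γ : ℝ} (hγ : 0 ≤ γ) :
    F (x - (γ / ‖g‖) • g) + γ * ‖gradient F x‖ ≤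
      F x + 2 * γ * ‖g - gradient F x‖ + L / 2 * γ ^ 2 := by
  have hpos : 0 < ‖g‖ := norm_pos_iff.2 hg
  have hnorm : ‖-((γ / ‖g‖) • g)‖ = γ := by
    rw [norm_neg, norm_smul, Real.norm_of_nonneg (by positivity), div_mul_cancel₀ _ hpos.ne']
  have hdesc := le_add_inner_gradient_add_sq_of_lipschitz_gradient hF hL x (-((γ / ‖g‖) • g))
  rw [hnorm, ← sub_eq_add_neg] at hdesc
  have herr := real_inner_le_norm (gradient F x - g) (-((γ / ‖g‖) • g))
  rw [hnorm, inner_sub_left, norm_sub_rev] at herr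
  have hself : inner ℝ g (-((γ / ‖g‖) • g)) = -(γ * ‖g‖) := by
    rw [inner_neg_right, real_inner_smul_right, real_inner_self_eq_norm_sq]
    field_simp
  have htri := mul_le_mul_of_nonneg_left (norm_sub_norm_le (gradient F x) g) hγ
  rw [norm_sub_rev (gradient F x) g] at htri
  linarith

/-- Descent Lemma (Lemma 2 of the paper) for one step of the normalized
distributed update, with the gradient-estimation error split into the momentum error
`‖v − ∇f(x)‖` and the per-client compression errors `‖g_i − v_i‖`. -/
theorem stmt2 {d n : ℕ} (hn : 0 < n)
    (f : Fin n → EuclideanSpace ℝ (Fin d) → ℝ)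
    (hdiff : ∀ i, Differentiable ℝ (f i))
    (F : EuclideanSpace ℝ (Fin d) → ℝ)
    (hF : F = fun z => (n : ℝ)⁻¹ * ∑ i, f i z)
    (L finf : ℝ)
    (hsmooth : ∀ a b : EuclideanSpace ℝ (Fin d),
      ‖gradient F a - gradient F b‖ ≤ L * ‖a - b‖)
    (hinf : IsGLB (Set.range F) finf)
    (x : EuclideanSpace ℝ (Fin d))
    (g v : Fin n → EuclideanSpace ℝ (Fin d))
    (gbar vbar : EuclideanSpace ℝ (Fin d))
    (hgbar : gbar = (n : ℝ)⁻¹ • ∑ i, g i)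
    (hvbar : vbar = (n : ℝ)⁻¹ • ∑ i, v i)
    (hg : gbar ≠ 0) (γ : ℝ) (hγ : 0 ≤ γ) :
    (F (x - (γ / ‖gbar‖) • gbar) - finf) + γ * ‖gradient F x‖ ≤
      (F x - finf) + 2 * γ * ‖vbar - gradient F x‖
        + (2 * γ / n) * ∑ i, ‖g i - v i‖ + L / 2 * γ ^ 2 := by
  have hFd : Differentiable ℝ F := by
    rw [hF]
    fun_prop
  have hstep := normalized_step_le hFd hsmooth x hg hγ
  have hmean : ‖gbar - vbar‖ ≤ (n : ℝ)⁻¹ * ∑ i, ‖g i - v i‖ := by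
    rw [hgbar, hvbar, ← smul_sub, ← Finset.sum_sub_distrib, norm_smul,
      Real.norm_of_nonneg (by positivity)]
    gcongr
    exact norm_sum_le _ _
  have htri : ‖gbar - gradient F x‖ ≤
      ‖vbar - gradient F x‖ + (n : ℝ)⁻¹ * ∑ i, ‖g i - v i‖ := by
    linarith [norm_sub_le_norm_sub_add_norm_sub gbar vbar (gradient F x)]
  have hmul := mul_le_mul_of_nonneg_left htri (mul_nonneg zero_le_two hγ)
  rw [mul_add, ← mul_assoc (2 * γ) (n : ℝ)⁻¹, ← div_eq_mul_inv] at hmul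
  linarith
end

section
/- Let q ∈ [0,1) and p ≥ 0, and define η_t = (2/(t+2))^q and γ_t = (2/(t+2))^p for every integer t ≥ 0. Then there exists a constant C > 0, depending only on p and q, such that for every integer T ≥ 1, ∑_{t=0}^{T−1} γ_t · ∏_{τ=t+1}^{T−1} (1 − η_τ) ≤ C · γ_T / η_T, where the empty product (for t = T−1) equals 1. -/
open Filter in
/-- A nonnegative sequence with `S (t + 1) = (1 - η t) * S t + η t * r t` is dominated by a multiple
of `r`, provided that `r` eventually decays at relative rate at most `η / 2`. -/
theorem exists_forall_le_mul_of_contraction {S η r : ℕ → ℝ} (hS : ∀ t, 0 ≤ S t)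
    (hη0 : ∀ t, 0 ≤ η t) (hη1 : ∀ t, η t ≤ 1) (hr : ∀ t, 0 < r t)
    (hrec : ∀ t, S (t + 1) = (1 - η t) * S t + η t * r t)
    (hdecay : ∀ᶠ t in atTop, r t * (1 - η t / 2) ≤ r (t + 1)) :
    ∃ C : ℝ, 0 < C ∧ ∀ t, S t ≤ C * r t := by
  obtain ⟨N, hN⟩ := eventually_atTop.1 hdecay
  have hdiv : ∀ t, 0 ≤ S t / r t := fun t => div_nonneg (hS t) (hr t).le
  set C : ℝ := 2 + ∑ t ∈ Finset.range (N + 1), S t / r t with hC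
  have hC2 : 2 ≤ C := le_add_of_nonneg_right (Finset.sum_nonneg fun t _ => hdiv t)
  have hinit : ∀ t ≤ N, S t ≤ C * r t := fun t ht => by
    have := Finset.single_le_sum (f := fun t => S t / r t) (fun t _ => hdiv t)
      (Finset.mem_range.2 (Nat.lt_succ_of_le ht))
    rw [← div_le_iff₀ (hr t)]
    linarith
  refine ⟨C, by linarith, fun t => ?_⟩
  rcases le_total t N with ht | ht
  · exact hinit t ht
  induction t, ht using Nat.le_induction with
  | base => exact hinit N le_rfl
  | succ t ht ih =>
    have h1 := mul_le_mul_of_nonneg_left ih (sub_nonneg.2 (hη1 t))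
    have h2 := mul_le_mul_of_nonneg_left (hN t ht) (by linarith : 0 ≤ C)
    have h3 := mul_le_mul_of_nonneg_right hC2 (mul_nonneg (hη0 t) (hr t).le)
    rw [hrec]
    linarith

open Filter in
/-- The ratio of consecutive terms of `(2 / (t + 2)) ^ s` is eventually at least
`1 - (2 / (t + 2)) ^ q / 2` when `q < 1`. -/
theorem eventually_rpow_two_div_mul_le {q : ℝ} (hq0 : 0 ≤ q) (hq1 : q < 1) (s : ℝ) :
    ∀ᶠ t : ℕ in atTop, (2 / ((t : ℝ) + 2)) ^ s * (1 - (2 / ((t : ℝ) + 2)) ^ q / 2) ≤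
      (2 / (((t + 1 : ℕ) : ℝ) + 2)) ^ s := by
  have htend : Tendsto (fun t : ℕ => ((t : ℝ) + 2) ^ (1 - q)) atTop atTop :=
    (tendsto_rpow_atTop (sub_pos.2 hq1)).comp
      (tendsto_atTop_add_const_right _ _ tendsto_natCast_atTop_atTop)
  filter_upwards [htend.eventually_ge_atTop (2 * max s 1)] with t ht
  have ht2 : (0 : ℝ) < (t : ℝ) + 2 := by positivity
  have ht3 : (0 : ℝ) < (t : ℝ) + 3 := by positivity
  have hratio : (2 / (((t + 1 : ℕ) : ℝ) + 2)) = 2 / ((t : ℝ) + 2) * (1 + -(1 / ((t : ℝ) + 3))) := by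
    push_cast
    have : (t : ℝ) + 1 + 2 ≠ 0 := by positivity
    field_simp
    ring
  have hpos : 0 < 1 + -(1 / ((t : ℝ) + 3)) := by
    have : 1 / ((t : ℝ) + 3) < 1 := by
      rw [div_lt_one ht3]; linarith [(Nat.cast_nonneg t : (0 : ℝ) ≤ t)]
    linarith
  rw [hratio, Real.mul_rpow (by positivity) hpos.le]
  refine mul_le_mul_of_nonneg_left ?_ (by positivity)
  have hbern : 1 + max s 1 * -(1 / ((t : ℝ) + 3)) ≤ (1 + -(1 / ((t : ℝ) + 3))) ^ max s 1 :=
    one_add_mul_self_le_rpow_one_add (by linarith) (le_max_right _ _)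
  have hmono : (1 + -(1 / ((t : ℝ) + 3))) ^ max s 1 ≤ (1 + -(1 / ((t : ℝ) + 3))) ^ s :=
    Real.rpow_le_rpow_of_exponent_ge hpos (by linarith [one_div_pos.2 ht3]) (le_max_left _ _)
  have hpow : 2 * max s 1 / ((t : ℝ) + 2) ≤ (2 / ((t : ℝ) + 2)) ^ q := calc
    2 * max s 1 / ((t : ℝ) + 2) ≤ ((t : ℝ) + 2) ^ (1 - q) / ((t : ℝ) + 2) := by gcongr
    _ = 1 / ((t : ℝ) + 2) ^ q := by
      rw [Real.rpow_sub ht2, Real.rpow_one]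
      field_simp
    _ ≤ 2 ^ q / ((t : ℝ) + 2) ^ q := by
      gcongr
      exact Real.one_le_rpow one_le_two hq0
    _ = (2 / ((t : ℝ) + 2)) ^ q := (Real.div_rpow zero_le_two ht2.le q).symm
  have hshift : 2 * max s 1 / ((t : ℝ) + 3) ≤ 2 * max s 1 / ((t : ℝ) + 2) := by
    gcongr
    norm_num
  have hrw : max s 1 * -(1 / ((t : ℝ) + 3)) = -(2 * max s 1 / ((t : ℝ) + 3)) / 2 := by ring
  linarith

/-- Sum–product schedule bound (Lemma 4 of the paper):
for `η_t = (2/(t+2))^q` and `γ_t = (2/(t+2))^p` with `q ∈ [0,1)`, `p ≥ 0`, there is a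
constant `C > 0` depending only on `p` and `q` such that
`∑_{t=0}^{T−1} γ_t ∏_{τ=t+1}^{T−1} (1−η_τ) ≤ C γ_T / η_T` for all `T ≥ 1`. -/
theorem stmt4 (q p : ℝ) (hq : q ∈ Set.Ico (0 : ℝ) 1) (hp : 0 ≤ p)
    (η γ : ℕ → ℝ)
    (hη : ∀ t : ℕ, η t = (2 / ((t : ℝ) + 2)) ^ q)
    (hγ : ∀ t : ℕ, γ t = (2 / ((t : ℝ) + 2)) ^ p) :
    ∃ C : ℝ, 0 < C ∧ ∀ T : ℕ, 1 ≤ T →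
      ∑ t ∈ Finset.range T, γ t * ∏ τ ∈ Finset.Ico (t + 1) T, (1 - η τ) ≤
        C * γ T / η T := by
  have hηpos : ∀ t, 0 < η t := fun t => by rw [hη]; positivity
  have hγpos : ∀ t, 0 < γ t := fun t => by rw [hγ]; positivity
  have hη1 : ∀ t, η t ≤ 1 := fun t => by
    rw [hη]
    refine Real.rpow_le_one (by positivity) ?_ hq.1
    rw [div_le_one (by positivity)]
    linarith [(Nat.cast_nonneg t : (0 : ℝ) ≤ t)]
  have hr : ∀ t : ℕ, γ t / η t = (2 / ((t : ℝ) + 2)) ^ (p - q) := fun t => by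
    rw [hγ, hη, Real.rpow_sub (by positivity)]
  obtain ⟨C, hC, hbound⟩ := exists_forall_le_mul_of_contraction
    (S := fun T => ∑ t ∈ Finset.range T, γ t * ∏ τ ∈ Finset.Ico (t + 1) T, (1 - η τ))
    (η := η) (r := fun t => γ t / η t)
    (fun T => Finset.sum_nonneg fun t _ => mul_nonneg (hγpos t).le
      (Finset.prod_nonneg fun τ _ => sub_nonneg.2 (hη1 τ)))
    (fun t => (hηpos t).le) hη1 (fun t => div_pos (hγpos t) (hηpos t))
    (fun T => by
      rw [Finset.sum_range_succ, Finset.Ico_self, Finset.prod_empty, mul_one,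
        mul_div_cancel₀ _ (hηpos T).ne', Finset.mul_sum]
      congr 1
      refine Finset.sum_congr rfl fun t ht => ?_
      rw [Finset.prod_Ico_succ_top (Finset.mem_range.1 ht)]
      ring)
    (by
      simp only [hr]
      simp only [hη]
      exact eventually_rpow_two_div_mul_le hq.1 hq.2 (p - q))
  exact ⟨C, hC, fun T _ => (hbound T).trans_eq (mul_div_assoc _ _ _).symm⟩
end
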